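/- arXiv:1907.02059 — 3 statements merged into one kernel-verified Lean document; each statement's English description precedes it below -/
import Mathlib

section
/- Let η > 0, Q ≥ 0 and T > 0, and let v : [0, T] → [0, ∞) be continuous. Assume that for every ξ ∈ (0, T] with v(ξ) ≠ 0 one has limsup_{τ↘0} (v(ξ) − v(ξ−τ))/τ ≤ η·Q·v(ξ)^{1 − 1/η}. Then v(t)^{1/η} − v(0)^{1/η} ≤ Q·t for every t ∈ [0, T]. -/
open Filter Topology

/-- If `v ^ (1 / η)` lies, to the left of `ξ`, below the line of slope `k` through its value at
`ξ`, then the upper backward Dini derivative of `v` at `ξ` is at least `η k v(ξ)^{1 - 1/η}`. -/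
theorem le_limsup_backward_difference_quotient {η k ξ : ℝ} {v : ℝ → ℝ} (hη : 0 < η)
    (hξ : 0 < ξ) (hvξ : 0 < v ξ) (hv : ∀ s ∈ Set.Icc 0 ξ, 0 ≤ v s)
    (hline : ∀ s ∈ Set.Icc 0 ξ, v s ^ (1 / η) ≤ v ξ ^ (1 / η) - k * (ξ - s)) :
    ((η * k * v ξ ^ (1 - 1 / η) : ℝ) : EReal) ≤
      limsup (fun τ : ℝ => (((v ξ - v (ξ - τ)) / τ : ℝ) : EReal)) (𝓝[>] (0 : ℝ)) := by
  have hpow : ∀ {x : ℝ}, 0 ≤ x → (x ^ (1 / η)) ^ η = x := fun hx => by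
    rw [← Real.rpow_mul hx, one_div_mul_cancel hη.ne', Real.rpow_one]
  have hu : 0 < v ξ ^ (1 / η) := Real.rpow_pos_of_pos hvξ _
  have hderiv : HasDerivAt (fun τ : ℝ => (v ξ ^ (1 / η) - k * τ) ^ η)
      (-(η * k * v ξ ^ (1 - 1 / η))) 0 := by
    have h := (((hasDerivAt_id' (0 : ℝ)).const_mul k).const_sub (v ξ ^ (1 / η))).rpow_const
      (p := η) (Or.inl (by simpa using hu.ne'))
    convert h using 1
    have he : 1 / η * (η - 1) = 1 - 1 / η := by field_simp
    simp only [mul_zero, sub_zero, mul_one]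
    rw [← Real.rpow_mul hvξ.le, he]
    ring
  have hlim : Tendsto (fun τ : ℝ => (v ξ - (v ξ ^ (1 / η) - k * τ) ^ η) / τ) (𝓝[>] 0)
      (𝓝 (η * k * v ξ ^ (1 - 1 / η))) := by
    have h := hderiv.tendsto_slope_zero_right.neg
    rw [neg_neg] at h
    refine h.congr fun τ => ?_
    simp only [zero_add, mul_zero, sub_zero, smul_eq_mul, hpow hvξ.le]
    ring
  rw [← ((continuous_coe_real_ereal.tendsto _).comp hlim).limsup_eq]
  refine limsup_le_limsup ?_
  filter_upwards [Ioo_mem_nhdsGT hξ] with τ hτ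
  have hs : ξ - τ ∈ Set.Icc 0 ξ := ⟨by linarith [hτ.2], by linarith [hτ.1]⟩
  have hle : v (ξ - τ) ≤ (v ξ ^ (1 / η) - k * τ) ^ η := by
    rw [← hpow (hv _ hs)]
    refine Real.rpow_le_rpow (Real.rpow_nonneg (hv _ hs) _) ?_ hη.le
    simpa using hline _ hs
  exact EReal.coe_le_coe_iff.2 (div_le_div_of_nonneg_right (sub_le_sub_left hle _) hτ.1.le)

/-- Lemma A.2: if `v : [0, T] → [0, ∞)` is continuous and its upper backward Dini
derivative satisfies `limsup ≤ η Q v(ξ)^{1 - 1/η}` at every `ξ ∈ (0, T]` with `v(ξ) ≠ 0`,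
then `v(t)^{1/η} - v(0)^{1/η} ≤ Q t` on `[0, T]`. -/
theorem backward_dini_power_bound
    (η Q T : ℝ) (hη : 0 < η) (hQ : 0 ≤ Q) (hT : 0 < T) (v : ℝ → ℝ)
    (hv : ContinuousOn v (Set.Icc 0 T))
    (hvnonneg : ∀ t ∈ Set.Icc (0 : ℝ) T, 0 ≤ v t)
    (hdini : ∀ ξ ∈ Set.Ioc (0 : ℝ) T, v ξ ≠ 0 →
      Filter.limsup (fun τ : ℝ => (((v ξ - v (ξ - τ)) / τ : ℝ) : EReal)) (𝓝[>] (0 : ℝ))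
        ≤ ((η * Q * v ξ ^ (1 - 1 / η) : ℝ) : EReal)) :
    ∀ t ∈ Set.Icc (0 : ℝ) T, v t ^ (1 / η) - v 0 ^ (1 / η) ≤ Q * t := by
  intro t ht
  refine le_of_forall_pos_le_add fun ε hε => ?_
  by_contra! hlt
  have htpos : 0 < t := by
    rcases ht.1.eq_or_lt with h | h
    · subst h
      norm_num at hlt
      linarith
    · exact h
  set k : ℝ := Q + ε / t with hk
  have hkQ : Q < k := by
    have : 0 < ε / t := by positivity
    linarith
  have hkt : k * t = Q * t + ε := by
    rw [hk]
    field_simp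
  have hcont : ContinuousOn (fun s => v s ^ (1 / η) - k * s) (Set.Icc 0 t) :=
    ((hv.mono (Set.Icc_subset_Icc_right ht.2)).rpow_const
      fun _ _ => Or.inr (by positivity)).sub (by fun_prop)
  obtain ⟨ξ, hξ, hmax⟩ :=
    isCompact_Icc.exists_isMaxOn (Set.nonempty_Icc.2 htpos.le) hcont
  have hgt : v t ^ (1 / η) - k * t ≤ v ξ ^ (1 / η) - k * ξ :=
    hmax (Set.right_mem_Icc.2 htpos.le)
  have h0 : 0 ≤ v 0 ^ (1 / η) := Real.rpow_nonneg (hvnonneg 0 ⟨le_rfl, hT.le⟩) _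
  have hξpos : 0 < ξ := by
    rcases hξ.1.eq_or_lt with h | h
    · rw [← h] at hgt
      linarith
    · exact h
  have hξT : ξ ∈ Set.Ioc (0 : ℝ) T := ⟨hξpos, hξ.2.trans ht.2⟩
  have hvξ : 0 ≤ v ξ := hvnonneg ξ ⟨hξpos.le, hξT.2⟩
  have hu : 0 < v ξ ^ (1 / η) := by
    have : 0 ≤ k * ξ := mul_nonneg (hQ.trans hkQ.le) hξpos.le
    linarith
  have hvne : v ξ ≠ 0 := by
    intro h
    rw [h, Real.zero_rpow (by positivity)] at hu
    exact hu.false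
  have hvpos : 0 < v ξ := lt_of_le_of_ne hvξ hvne.symm
  refine (hdini ξ hξT hvne).not_gt (lt_of_lt_of_le (EReal.coe_lt_coe_iff.2 ?_)
    (le_limsup_backward_difference_quotient hη hξpos hvpos
      (fun s hs => hvnonneg s ⟨hs.1, hs.2.trans hξT.2⟩) (k := k) fun s hs => ?_))
  · gcongr
  · have : v s ^ (1 / η) - k * s ≤ v ξ ^ (1 / η) - k * ξ := hmax ⟨hs.1, hs.2.trans hξ.2⟩
    linarith
end

section
/- Let a, T > 0 and b ≥ 0, and let J : [0, T] → ℝ be continuous. Assume that for every t ∈ (0, T] one has limsup_{τ↘0} (J(t) − J(t−τ))/τ ≤ a·J(t) + b. Then J(t) ≤ J(0)·e^{a t} + (e^{a t} − 1)·b/a for every t ∈ [0, T]. -/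
open Filter Topology

/-- A continuous function on `[0, T]` which, immediately to the left of each `t ∈ (0, T]`, takes
values larger than at `t`, attains its maximum at `0`. -/
theorem le_left_endpoint_of_frequently_lt_sub {T : ℝ} {h : ℝ → ℝ}
    (hc : ContinuousOn h (Set.Icc 0 T))
    (hlt : ∀ t ∈ Set.Ioc (0 : ℝ) T, ∃ᶠ τ in 𝓝[>] (0 : ℝ), h t < h (t - τ)) :
    ∀ t ∈ Set.Icc (0 : ℝ) T, h t ≤ h 0 := by
  intro t ht
  obtain ⟨ξ, hξ, hmax⟩ := isCompact_Icc.exists_isMaxOn ⟨t, ht⟩ hc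
  rcases hξ.1.eq_or_lt with h0 | hpos
  · rw [h0]
    exact hmax ht
  · obtain ⟨τ, hτlt, hτ⟩ :=
      ((hlt ξ ⟨hpos, hξ.2⟩).and_eventually (Ioo_mem_nhdsGT hpos)).exists
    have hmem : ξ - τ ∈ Set.Icc 0 T := ⟨by linarith [hτ.2], by linarith [hτ.1, hξ.2]⟩
    exact absurd (hmax hmem) (not_le.2 hτlt)

/-- For `φ τ = (k - δ τ) e^{-a τ}` with `δ > 0`, the quotient `(φ 0 - φ τ) / τ` eventually
exceeds `a k + δ / 2` as `τ ↘ 0`. -/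
theorem eventually_lt_div_sub_mul_exp (a k : ℝ) {δ : ℝ} (hδ : 0 < δ) :
    ∀ᶠ τ in 𝓝[>] (0 : ℝ), a * k + δ / 2 < (k - (k - δ * τ) * Real.exp (-(a * τ))) / τ := by
  have hd : HasDerivAt (fun τ : ℝ => k - (k - δ * τ) * Real.exp (-(a * τ))) (a * k + δ) 0 := by
    have h1 : HasDerivAt (fun τ : ℝ => k - δ * τ) (-δ) 0 := by
      simpa using ((hasDerivAt_id (0 : ℝ)).const_mul δ).const_sub k
    have h2 : HasDerivAt (fun τ : ℝ => Real.exp (-(a * τ))) (-a) 0 := by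
      simpa using (((hasDerivAt_id (0 : ℝ)).const_mul a).neg).exp
    refine ((h1.mul h2).const_sub k).congr_deriv ?_
    simp
    ring
  have hs := hd.hasDerivWithinAt (s := Set.Ioi 0)
  rw [hasDerivWithinAt_iff_tendsto_slope' (by simp)] at hs
  filter_upwards [hs.eventually (lt_mem_nhds (show a * k + δ / 2 < a * k + δ by linarith))]
    with τ hτ
  simpa [slope_def_field] using hτ

/-- Lemma A.3: a Grönwall-type inequality for backward difference quotients. If
`J : [0, T] → ℝ` is continuous and `limsup_{τ↘0} (J(t) - J(t-τ))/τ ≤ a J(t) + b` for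
every `t ∈ (0, T]`, then `J(t) ≤ J(0) e^{a t} + (e^{a t} - 1) b / a` on `[0, T]`. -/
theorem backward_dini_gronwall
    (a b T : ℝ) (ha : 0 < a) (hb : 0 ≤ b) (hT : 0 < T) (J : ℝ → ℝ)
    (hJ : ContinuousOn J (Set.Icc 0 T))
    (hdini : ∀ t ∈ Set.Ioc (0 : ℝ) T,
      Filter.limsup (fun τ : ℝ => (((J t - J (t - τ)) / τ : ℝ) : EReal)) (𝓝[>] (0 : ℝ))
        ≤ ((a * J t + b : ℝ) : EReal)) :
    ∀ t ∈ Set.Icc (0 : ℝ) T,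
      J t ≤ J 0 * Real.exp (a * t) + (Real.exp (a * t) - 1) * b / a := by
  intro t ht
  have key : (J t + b / a) * Real.exp (-(a * t)) ≤ J 0 + b / a := by
    refine le_of_forall_pos_le_add fun ε hε => ?_
    have hεT : 0 < ε / T := div_pos hε hT
    have hmono := le_left_endpoint_of_frequently_lt_sub
      (h := fun s => (J s + b / a) * Real.exp (-(a * s)) - ε / T * s) (T := T)
      (((hJ.add continuousOn_const).mul (by fun_prop)).sub (by fun_prop)) ?_ t ht
    · have hle : ε / T * t ≤ ε := by
        calc ε / T * t ≤ ε / T * T := by gcongr; exact ht.2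
          _ = ε := by field_simp
      simp only [mul_zero, neg_zero, Real.exp_zero, mul_one, sub_zero] at hmono
      linarith
    · intro s hs
      have hδ : 0 < ε / T * Real.exp (a * s) := by positivity
      have hab : a * (J s + b / a) = a * J s + b := by field_simp
      have hlim : Filter.limsup (fun τ : ℝ => (((J s - J (s - τ)) / τ : ℝ) : EReal)) (𝓝[>] (0 : ℝ))
          < ((a * (J s + b / a) + ε / T * Real.exp (a * s) / 2 : ℝ) : EReal) := by
        refine (hdini s hs).trans_lt (EReal.coe_lt_coe_iff.2 ?_)
        linarith
      refine Eventually.frequently ?_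
      filter_upwards [eventually_lt_of_limsup_lt hlim,
        eventually_lt_div_sub_mul_exp a (J s + b / a) hδ, self_mem_nhdsWithin] with τ h1 h2 hτ
      have h3 := (div_lt_div_iff_of_pos_right hτ).1 ((EReal.coe_lt_coe_iff.1 h1).trans h2)
      have h4 : (J s + b / a - ε / T * Real.exp (a * s) * τ) * Real.exp (-(a * τ))
          < J (s - τ) + b / a := by linarith
      have h5 := mul_lt_mul_of_pos_right h4 (Real.exp_pos (-(a * (s - τ))))
      have e1 : Real.exp (-(a * τ)) * Real.exp (-(a * (s - τ))) = Real.exp (-(a * s)) := by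
        rw [← Real.exp_add]
        ring_nf
      have e2 : Real.exp (a * s) * Real.exp (-(a * s)) = 1 := by
        rw [← Real.exp_add, add_neg_cancel, Real.exp_zero]
      rw [mul_assoc, e1] at h5
      linear_combination h5 + ε / T * τ * e2
  rw [Real.exp_neg, ← div_eq_mul_inv, div_le_iff₀ (Real.exp_pos _)] at key
  linear_combination key
end

section
/- Let m ≥ 1, let f : ℝ^m → ℝ be smooth, and let φ : ℝ^m → ℝ be smooth, nonnegative and compactly supported. Then ∫_{{x : f(x) > 0}} (φ(x)·Δf(x) − f(x)·Δφ(x)) dx ≤ 0, where Δ denotes the Euclidean Laplacian (the sum of second partial derivatives) and the integral is with respect to Lebesgue measure. -/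
open MeasureTheory

/-- The Euclidean Laplacian: the sum of the second partial derivatives. -/
noncomputable def euclideanLaplacian {m : ℕ} (u : EuclideanSpace ℝ (Fin m) → ℝ)
    (x : EuclideanSpace ℝ (Fin m)) : ℝ :=
  ∑ i : Fin m,
    fderiv ℝ (fun y => fderiv ℝ u y (EuclideanSpace.single i 1)) x (EuclideanSpace.single i 1)

open Filter Topology

theorem hasDerivAt_sq_max_zero (t : ℝ) :
    HasDerivAt (fun s : ℝ => max s 0 ^ 2) (2 * max t 0) t := by
  rcases lt_trichotomy t 0 with ht | rfl | ht
  · have h : (fun s : ℝ => max s 0 ^ 2) =ᶠ[𝓝 t] fun _ => 0 := by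
      filter_upwards [gt_mem_nhds ht] with s hs
      simp [max_eq_right hs.le]
    simpa [max_eq_right ht.le] using (hasDerivAt_const t (0 : ℝ)).congr_of_eventuallyEq h
  · rw [hasDerivAt_iff_isLittleO]
    have h : (fun s : ℝ => max s 0 ^ 2) =O[𝓝 0] fun s => s ^ 2 := by
      refine Asymptotics.IsBigO.of_bound 1 (Eventually.of_forall fun s => ?_)
      rcases le_total s 0 with hs | hs <;> simp [hs, sq_nonneg]
    simpa using h.trans_isLittleO (by simpa using Asymptotics.isLittleO_pow_id (𝕜 := ℝ) one_lt_two)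
  · have h : (fun s : ℝ => max s 0 ^ 2) =ᶠ[𝓝 t] fun s => s ^ 2 := by
      filter_upwards [lt_mem_nhds ht] with s hs
      simp [max_eq_left hs.le]
    simpa [max_eq_left ht.le] using (hasDerivAt_pow 2 t).congr_of_eventuallyEq h

/-- A continuously differentiable, nondecreasing approximation of the Heaviside function
(as `δ → 0⁺`) that vanishes on the nonpositive half-line. -/
noncomputable def approxHeaviside (δ t : ℝ) : ℝ := max t 0 ^ 2 / (δ + max t 0 ^ 2)

/-- The derivative of `approxHeaviside δ`. -/
noncomputable def approxHeavisideDeriv (δ t : ℝ) : ℝ :=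
  2 * max t 0 * δ / (δ + max t 0 ^ 2) ^ 2

section approxHeaviside

variable {δ : ℝ}

theorem hasDerivAt_approxHeaviside (hδ : 0 < δ) (t : ℝ) :
    HasDerivAt (approxHeaviside δ) (approxHeavisideDeriv δ t) t := by
  have h := hasDerivAt_sq_max_zero t
  have hne : δ + max t 0 ^ 2 ≠ 0 := by positivity
  refine (h.fun_div (h.const_add δ) hne).congr_deriv ?_
  rw [approxHeavisideDeriv]
  congr 1
  ring

theorem continuous_approxHeaviside (hδ : 0 < δ) : Continuous (approxHeaviside δ) := by
  unfold approxHeaviside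
  exact Continuous.div (by fun_prop) (by fun_prop) fun t => by positivity

theorem continuous_approxHeavisideDeriv (hδ : 0 < δ) : Continuous (approxHeavisideDeriv δ) := by
  unfold approxHeavisideDeriv
  exact Continuous.div (by fun_prop) (by fun_prop) fun t => by positivity

theorem approxHeavisideDeriv_nonneg (hδ : 0 < δ) (t : ℝ) : 0 ≤ approxHeavisideDeriv δ t := by
  unfold approxHeavisideDeriv
  positivity

theorem abs_approxHeaviside_le_one (hδ : 0 < δ) (t : ℝ) : |approxHeaviside δ t| ≤ 1 := by
  unfold approxHeaviside
  rw [abs_of_nonneg (by positivity)]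
  exact div_le_one_of_le₀ (by linarith) (by positivity)

theorem abs_approxHeavisideDeriv_mul_self_le_two (hδ : 0 < δ) (t : ℝ) :
    |approxHeavisideDeriv δ t * t| ≤ 2 := by
  unfold approxHeavisideDeriv
  rcases le_total t 0 with ht | ht
  · simp [ht]
  · rw [max_eq_left ht, abs_of_nonneg (by positivity), div_mul_eq_mul_div,
      div_le_iff₀ (by positivity)]
    nlinarith [sq_nonneg δ, sq_nonneg (t ^ 2), mul_nonneg hδ.le (sq_nonneg t)]

theorem tendsto_approxHeaviside (t : ℝ) :
    Tendsto (fun δ => approxHeaviside δ t) (𝓝[>] 0) (𝓝 (if 0 < t then 1 else 0)) := by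
  unfold approxHeaviside
  split_ifs with ht
  · rw [max_eq_left ht.le]
    have h : ContinuousAt (fun δ : ℝ => t ^ 2 / (δ + t ^ 2)) 0 :=
      ContinuousAt.div (by fun_prop) (by fun_prop) (by positivity)
    have h' := h.tendsto
    simp only [zero_add, div_self (pow_pos ht 2).ne'] at h'
    exact h'.mono_left nhdsWithin_le_nhds
  · simp [max_eq_right (not_lt.mp ht)]

theorem tendsto_approxHeavisideDeriv (t : ℝ) :
    Tendsto (fun δ => approxHeavisideDeriv δ t) (𝓝[>] 0) (𝓝 0) := by
  unfold approxHeavisideDeriv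
  rcases le_or_gt t 0 with ht | ht
  · simp [ht]
  · rw [max_eq_left ht.le]
    have h : ContinuousAt (fun δ : ℝ => 2 * t * δ / (δ + t ^ 2) ^ 2) 0 :=
      ContinuousAt.div (by fun_prop) (by fun_prop) (by positivity)
    have h' := h.tendsto
    simp only [mul_zero, zero_div] at h'
    exact h'.mono_left nhdsWithin_le_nhds

end approxHeaviside

section lineDeriv

variable {E : Type*} [NormedAddCommGroup E] [NormedSpace ℝ E] [FiniteDimensional ℝ E]
  [MeasurableSpace E] [BorelSpace E] {μ : Measure E} [μ.IsAddHaarMeasure]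

theorem integral_eq_zero_of_hasLineDerivAt {G G' : E → ℝ} {v : E} (hG : Integrable G μ)
    (hG' : Integrable G' μ) (h : ∀ x, HasLineDerivAt ℝ G (G' x) x v) :
    ∫ x, G' x ∂μ = 0 := by
  have key := integral_bilinear_hasLineDerivAt_right_eq_neg_left_of_integrable (μ := μ)
    (f := fun _ => (1 : ℝ)) (f' := fun _ => 0) (g := G) (g' := G') (v := v)
    (B := ContinuousLinearMap.mul ℝ ℝ) (by simp) (by simpa using hG') (by simpa using hG)
    (fun x _ => hasDerivAt_const _ _) (fun x _ => h x)
  simpa using key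

theorem setIntegral_pos_mul_lineDeriv_sub_nonpos {f φ f' φ' f'' φ'' : E → ℝ} {v : E}
    (hf : ∀ x, HasLineDerivAt ℝ f (f' x) x v) (hf' : ∀ x, HasLineDerivAt ℝ f' (f'' x) x v)
    (hφ : ∀ x, HasLineDerivAt ℝ φ (φ' x) x v) (hφ' : ∀ x, HasLineDerivAt ℝ φ' (φ'' x) x v)
    (cf : Continuous f) (cf' : Continuous f') (cf'' : Continuous f'')
    (cφ : Continuous φ) (cφ' : Continuous φ') (cφ'' : Continuous φ'')
    (sφ : HasCompactSupport φ) (sφ' : HasCompactSupport φ') (sφ'' : HasCompactSupport φ'')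
    (hφ0 : ∀ x, 0 ≤ φ x) :
    ∫ x in {x | 0 < f x}, (φ x * f'' x - f x * φ'' x) ∂μ ≤ 0 := by
  have iK : Integrable (fun x => φ x * f'' x - f x * φ'' x) μ :=
    ((cφ.mul cf'').integrable_of_hasCompactSupport sφ.mul_right).sub
      ((cf.mul cφ'').integrable_of_hasCompactSupport sφ''.mul_left)
  have iL : Integrable (fun x => f' x * φ' x) μ :=
    (cf'.mul cφ').integrable_of_hasCompactSupport sφ'.mul_left
  have hle : ∀ δ : ℝ, 0 < δ →
      ∫ x, approxHeaviside δ (f x) * (φ x * f'' x - f x * φ'' x) ∂μ ≤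
        ∫ x, approxHeavisideDeriv δ (f x) * f x * (f' x * φ' x) ∂μ := by
    intro δ hδ
    have cH := (continuous_approxHeaviside hδ).comp cf
    have cH' := (continuous_approxHeavisideDeriv hδ).comp cf
    have i1 : Integrable (fun x => approxHeaviside δ (f x) * (φ x * f'' x - f x * φ'' x)) μ :=
      iK.bdd_mul cH.aestronglyMeasurable
        (Eventually.of_forall fun x => abs_approxHeaviside_le_one hδ (f x))
    have i2 : Integrable (fun x => approxHeavisideDeriv δ (f x) * f x * (f' x * φ' x)) μ :=
      iL.bdd_mul (cH'.mul cf).aestronglyMeasurable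
        (Eventually.of_forall fun x => abs_approxHeavisideDeriv_mul_self_le_two hδ (f x))
    have i3 : Integrable (fun x => approxHeavisideDeriv δ (f x) * f' x ^ 2 * φ x) μ :=
      ((cH'.mul (cf'.pow 2)).mul cφ).integrable_of_hasCompactSupport sφ.mul_left
    have iG : Integrable
        (fun x => approxHeaviside δ (f x) * (φ x * f' x - f x * φ' x)) μ := by
      refine Integrable.bdd_mul (c := 1) ?_ cH.aestronglyMeasurable
        (Eventually.of_forall fun x => abs_approxHeaviside_le_one hδ (f x))
      exact ((cφ.mul cf').integrable_of_hasCompactSupport sφ.mul_right).sub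
        ((cf.mul cφ').integrable_of_hasCompactSupport sφ'.mul_left)
    have h0 := integral_eq_zero_of_hasLineDerivAt (v := v) iG ((i1.add i3).sub i2) fun x => by
      have hH : HasDerivAt (approxHeaviside δ) (approxHeavisideDeriv δ (f x))
          (f (x + (0 : ℝ) • v)) := by
        simpa using hasDerivAt_approxHeaviside hδ (f x)
      refine ((hH.comp (0 : ℝ) (hf x)).fun_mul
        (((hφ x).fun_mul (hf' x)).fun_sub ((hf x).fun_mul (hφ' x)))).congr_deriv ?_
      simp
      ring
    rw [integral_sub' (i1.add i3) i2, integral_add' i1 i3] at h0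
    have h1 : 0 ≤ ∫ x, approxHeavisideDeriv δ (f x) * f' x ^ 2 * φ x ∂μ :=
      integral_nonneg fun x => mul_nonneg
        (mul_nonneg (approxHeavisideDeriv_nonneg hδ _) (sq_nonneg _)) (hφ0 x)
    linarith
  have hpos : ∀ᶠ δ : ℝ in 𝓝[>] 0, 0 < δ := self_mem_nhdsWithin
  have l1 : Tendsto (fun δ => ∫ x, approxHeaviside δ (f x) * (φ x * f'' x - f x * φ'' x) ∂μ)
      (𝓝[>] 0) (𝓝 (∫ x, (if 0 < f x then 1 else 0) * (φ x * f'' x - f x * φ'' x) ∂μ)) := by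
    refine tendsto_integral_filter_of_dominated_convergence _ ?_ ?_ iK.norm ?_
    · filter_upwards [hpos] with δ hδ
      exact ((continuous_approxHeaviside hδ).comp cf).aestronglyMeasurable.mul
        iK.aestronglyMeasurable
    · filter_upwards [hpos] with δ hδ
      refine Eventually.of_forall fun x => ?_
      rw [norm_mul]
      exact mul_le_of_le_one_left (norm_nonneg _) (abs_approxHeaviside_le_one hδ _)
    · exact Eventually.of_forall fun x => (tendsto_approxHeaviside (f x)).mul_const _
  have l2 : Tendsto (fun δ => ∫ x, approxHeavisideDeriv δ (f x) * f x * (f' x * φ' x) ∂μ)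
      (𝓝[>] 0) (𝓝 (∫ _, 0 ∂μ)) := by
    refine tendsto_integral_filter_of_dominated_convergence _ ?_ ?_ (iL.norm.const_mul 2) ?_
    · filter_upwards [hpos] with δ hδ
      exact (((continuous_approxHeavisideDeriv hδ).comp cf).mul cf).aestronglyMeasurable.mul
        iL.aestronglyMeasurable
    · filter_upwards [hpos] with δ hδ
      refine Eventually.of_forall fun x => ?_
      rw [norm_mul]
      exact mul_le_mul_of_nonneg_right (abs_approxHeavisideDeriv_mul_self_le_two hδ _)
        (norm_nonneg _)
    · refine Eventually.of_forall fun x => ?_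
      simpa using ((tendsto_approxHeavisideDeriv (f x)).mul_const (f x)).mul_const (f' x * φ' x)
  have hlim := le_of_tendsto_of_tendsto l1 l2 (hpos.mono hle)
  rw [integral_zero] at hlim
  rw [← integral_indicator (isOpen_lt continuous_const cf).measurableSet]
  refine le_of_eq_of_le (integral_congr_ae (Eventually.of_forall fun x => ?_)) hlim
  by_cases hx : 0 < f x <;> simp [hx]

end lineDeriv

theorem ContDiff.fderiv_apply_const {E : Type*} [NormedAddCommGroup E] [NormedSpace ℝ E]
    {u : E → ℝ} (hu : ContDiff ℝ (⊤ : ℕ∞) u) (v : E) :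
    ContDiff ℝ (⊤ : ℕ∞) (fun x => fderiv ℝ u x v) :=
  (hu.fderiv_right (by simp)).clm_apply contDiff_const

theorem ContDiff.hasLineDerivAt_fderiv {E : Type*} [NormedAddCommGroup E] [NormedSpace ℝ E]
    {u : E → ℝ} (hu : ContDiff ℝ (⊤ : ℕ∞) u) (x v : E) :
    HasLineDerivAt ℝ u (fderiv ℝ u x v) x v :=
  (hu.differentiable (by simp) x).hasFDerivAt.hasLineDerivAt v

/-- Inequality (32), Euclidean version: for smooth `f` and smooth, nonnegative,
compactly supported `φ`, the integral of `φ Δf - f Δφ` over the set `{f > 0}`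
is nonpositive. -/
theorem integral_superlevel_laplacian_nonpos
    (m : ℕ) (hm : 1 ≤ m) (f φ : EuclideanSpace ℝ (Fin m) → ℝ)
    (hf : ContDiff ℝ (⊤ : ℕ∞) f) (hφ : ContDiff ℝ (⊤ : ℕ∞) φ)
    (hφ0 : ∀ x, 0 ≤ φ x) (hφc : HasCompactSupport φ) :
    ∫ x in {x | 0 < f x}, (φ x * euclideanLaplacian f x - f x * euclideanLaplacian φ x)
      ≤ 0 := by
  have cf := fun i : Fin m => hf.fderiv_apply_const (EuclideanSpace.single i 1)
  have cφ := fun i : Fin m => hφ.fderiv_apply_const (EuclideanSpace.single i 1)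
  have cf2 := fun i : Fin m => (cf i).fderiv_apply_const (EuclideanSpace.single i 1)
  have cφ2 := fun i : Fin m => (cφ i).fderiv_apply_const (EuclideanSpace.single i 1)
  have sφ := fun i : Fin m => hφc.fderiv_apply ℝ (EuclideanSpace.single i 1)
  have sφ2 := fun i : Fin m => (sφ i).fderiv_apply ℝ (EuclideanSpace.single i 1)
  simp only [euclideanLaplacian, Finset.mul_sum, ← Finset.sum_sub_distrib]
  rw [integral_finsetSum]
  · exact Finset.sum_nonpos fun i _ => setIntegral_pos_mul_lineDeriv_sub_nonpos
      (fun x => hf.hasLineDerivAt_fderiv x _) (fun x => (cf i).hasLineDerivAt_fderiv x _)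
      (fun x => hφ.hasLineDerivAt_fderiv x _) (fun x => (cφ i).hasLineDerivAt_fderiv x _)
      hf.continuous (cf i).continuous (cf2 i).continuous
      hφ.continuous (cφ i).continuous (cφ2 i).continuous hφc (sφ i) (sφ2 i) hφ0
  · intro i _
    exact (((hφ.continuous.mul (cf2 i).continuous).integrable_of_hasCompactSupport
      hφc.mul_right).sub ((hf.continuous.mul (cφ2 i).continuous).integrable_of_hasCompactSupport
      (sφ2 i).mul_left)).integrableOn
end
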